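/- Let 0 < r₁ < r₂, r_m = (r₁+r₂)/2, and let A^H be defined on B_{r₂} \ B_{r₁} ⊂ ℝ^d (d = 2 or 3) by A^H = r^{1−d} e_r ⊗ e_r − r^{3−d}(I − e_r ⊗ e_r) on B_{r₂} \ B_{r_m} and A^H = −r^{1−d} e_r ⊗ e_r + r^{3−d}(I − e_r ⊗ e_r) on B_{r_m} \ B_{r₁}. Suppose u is C² on each subannulus, satisfies div(A^H∇u) = 0 there, and satisfies the transmission conditions [u] = 0 and [A^H∇u·e_r] = 0 across ∂B_{r_m}. Then u(r₂ x̂) = u(r₁ x̂) and ∂_r u(r₂ x̂) = −∂_r u(r₁ x̂) for all unit vectors x̂. -/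

import Mathlib

open Set

noncomputable section

-- The degree-zero homogeneous extension of a function on the unit sphere in `ℝ^d`.
open scoped Classical in
def extSd (d : ℕ) (g : Metric.sphere (0 : EuclideanSpace ℝ (Fin d)) 1 → ℝ)
    (y : EuclideanSpace ℝ (Fin d)) : ℝ :=
  if h : y = 0 then 0
  else g ⟨‖y‖⁻¹ • y, by
    rw [mem_sphere_zero_iff_norm, norm_smul, norm_inv, norm_norm,
      inv_mul_cancel₀ (norm_ne_zero_iff.mpr h)]⟩

/-- Second directional derivative. -/
def sddR (d : ℕ) (f : EuclideanSpace ℝ (Fin d) → ℝ) (x v : EuclideanSpace ℝ (Fin d)) : ℝ :=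
  fderiv ℝ (fun y => fderiv ℝ f y v) x v

/-- The Laplace–Beltrami operator on the unit sphere `S^{d-1}`, realized as the Euclidean
Laplacian of the degree-zero homogeneous extension, evaluated on the unit sphere. -/
def lapSd (d : ℕ) (g : Metric.sphere (0 : EuclideanSpace ℝ (Fin d)) 1 → ℝ)
    (x : Metric.sphere (0 : EuclideanSpace ℝ (Fin d)) 1) : ℝ :=
  ∑ i : Fin d, sddR d (extSd d g) (x : EuclideanSpace ℝ (Fin d))
    (EuclideanSpace.single i (1 : ℝ))

lemma aux_bump : ∃ β : ℝ → ℝ, ContDiff ℝ 1 β ∧ β 1 = 1 ∧ (∀ t, 0 ≤ β t) ∧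
    (∀ t, t < 1/2 → β t = 0) ∧ (∀ t, 2 < t → β t = 0) := by
  let b : ContDiffBump (1:ℝ) := ⟨1/4, 1/2, by norm_num, by norm_num⟩
  refine ⟨b, b.contDiff, ?_, fun t => b.nonneg, ?_, ?_⟩
  · exact b.one_of_mem_closedBall (by simp [b])
  · intro t ht
    apply b.zero_of_le_dist
    simp only [b, Real.dist_eq]
    rw [abs_of_neg] <;> linarith
  · intro t ht
    apply b.zero_of_le_dist
    simp only [b, Real.dist_eq]
    rw [abs_of_pos] <;> linarith

lemma aux_cut_cont {E : Type*} [NormedAddCommGroup E] (I : Set ℝ) (f : ℝ × E → ℝ)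
    (hf : ContinuousOn f (I ×ˢ {y : E | y ≠ 0})) (φ : E → ℝ) (hφ : Continuous φ)
    (h0 : ∀ᶠ y in nhds (0:E), φ y = 0) :
    ContinuousOn (fun p : ℝ × E => φ p.2 * f p) (I ×ˢ univ) := by
  rintro ⟨s, y⟩ ⟨hs, -⟩
  by_cases hy : y = 0
  · subst hy
    apply ContinuousAt.continuousWithinAt
    have : (fun p : ℝ × E => φ p.2 * f p) =ᶠ[nhds (s, (0:E))] fun _ => 0 := by
      have h := (continuous_snd (X := ℝ) (Y := E)).tendsto (s, (0:E))
      filter_upwards [h.eventually h0] with p hp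
      simp [hp]
    exact (continuousAt_const).congr this.symm
  · have h1 : ContinuousWithinAt f (I ×ˢ univ) (s, y) := by
      have := hf (s, y) ⟨hs, hy⟩
      apply this.mono_of_mem_nhdsWithin
      have h2 : (Prod.snd ⁻¹' {y : E | y ≠ 0} : Set (ℝ × E)) ∈ nhds (s, y) :=
        (isOpen_ne.preimage continuous_snd).mem_nhds hy
      filter_upwards [self_mem_nhdsWithin, mem_nhdsWithin_of_mem_nhds h2] with p hp hp2
      exact ⟨hp.1, hp2⟩
    exact ((hφ.comp continuous_snd).continuousWithinAt).mul h1

lemma aux_integral_fderiv {d : ℕ} (f : EuclideanSpace ℝ (Fin d) → ℝ)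
    (hf : Differentiable ℝ f) (hs : HasCompactSupport f) (v : EuclideanSpace ℝ (Fin d))
    (hc : Continuous fun y => fderiv ℝ f y v) : ∫ y, fderiv ℝ f y v = 0 := by
  have := integral_mul_fderiv_eq_neg_fderiv_mul_of_integrable
    (μ := (MeasureTheory.volume : MeasureTheory.Measure (EuclideanSpace ℝ (Fin d))))
    (f := fun _ => (1:ℝ)) (g := f) (v := v) (by simp)
    (by simpa using hc.integrable_of_hasCompactSupport (hs.fderiv_apply ℝ v))
    (by simpa using hf.continuous.integrable_of_hasCompactSupport hs)
    (fun x _ => by fun_prop) (fun x _ => hf x)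
  simpa using this

lemma aux_energy {d : ℕ} (T : ℝ) (hT : 0 < T)
    (P : ℝ × EuclideanSpace ℝ (Fin d) → ℝ) (Q : Fin d → ℝ × EuclideanSpace ℝ (Fin d) → ℝ)
    (DP : ℝ × EuclideanSpace ℝ (Fin d) → (ℝ × EuclideanSpace ℝ (Fin d) →L[ℝ] ℝ))
    (DQ : Fin d → ℝ × EuclideanSpace ℝ (Fin d) → (ℝ × EuclideanSpace ℝ (Fin d) →L[ℝ] ℝ))
    (hP : ContinuousOn P (Icc 0 T ×ˢ {y | y ≠ 0}))
    (hQ : ∀ i, ContinuousOn (Q i) (Icc 0 T ×ˢ {y | y ≠ 0}))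
    (hDPc : ContinuousOn DP (Ioo 0 T ×ˢ {y | y ≠ 0}))
    (hDQc : ∀ i, ContinuousOn (DQ i) (Ioo 0 T ×ˢ {y | y ≠ 0}))
    (hDP : ∀ p ∈ Ioo 0 T ×ˢ {y | y ≠ 0}, HasFDerivAt P (DP p) p)
    (hDQ : ∀ i, ∀ p ∈ Ioo 0 T ×ˢ {y | y ≠ 0}, HasFDerivAt (Q i) (DQ i p) p)
    (hsym : ∀ i, ∀ p ∈ Ioo 0 T ×ˢ {y | y ≠ 0},
      DQ i p (1, 0) = DP p (0, EuclideanSpace.single i 1))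
    (hw : ∀ p ∈ Ioo 0 T ×ˢ {y | y ≠ 0},
      DP p (1, 0) = ‖p.2‖ ^ 2 * ∑ i, DQ i p (0, EuclideanSpace.single i 1))
    (hE : ∀ p ∈ Ioo 0 T ×ˢ {y : EuclideanSpace ℝ (Fin d) | y ≠ 0}, ∑ i, p.2 i * Q i p = 0)
    (hP0 : ∀ y, y ≠ 0 → P (0, y) = 0) (hQ0 : ∀ i, ∀ y, y ≠ 0 → Q i (0, y) = 0) :
    ∀ s ∈ Icc 0 T, ∀ y, ‖y‖ = 1 → P (s, y) = 0 := by
  obtain ⟨β, hβ, hβ1, hβn, hβs, hβl⟩ := aux_bump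
  set φ : EuclideanSpace ℝ (Fin d) → ℝ := fun y => β (‖y‖ ^ 2) with hφ
  have hφc : Continuous φ := hβ.continuous.comp (by fun_prop)
  have hφ0 : ∀ᶠ y in nhds (0 : EuclideanSpace ℝ (Fin d)), φ y = 0 := by
    have : ∀ᶠ y in nhds (0 : EuclideanSpace ℝ (Fin d)), ‖y‖ ^ 2 < 1/2 := by
      apply (continuous_norm.pow 2).continuousAt.eventually_lt continuousAt_const
      simp
    filter_upwards [this] with y hy using hβs _ hy
  have hφ00 : φ 0 = 0 := hφ0.self_of_nhds
  have hφK : ∀ y, y ∉ Metric.closedBall (0 : EuclideanSpace ℝ (Fin d)) 2 → φ y = 0 := by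
    intro y hy
    apply hβl
    simp at hy
    nlinarith
  set e : ℝ → EuclideanSpace ℝ (Fin d) → ℝ := fun s y =>
    φ y * (P (s, y) ^ 2 + ‖y‖ ^ 2 * ∑ i, Q i (s, y) ^ 2) with he
  set e' : ℝ → EuclideanSpace ℝ (Fin d) → ℝ := fun s y =>
    φ y * (2 * P (s, y) * DP (s, y) (1, 0)
      + ‖y‖ ^ 2 * ∑ i, 2 * Q i (s, y) * DQ i (s, y) (1, 0)) with he'
  have hsub : (Ioo 0 T ×ˢ {y : EuclideanSpace ℝ (Fin d) | y ≠ 0}) ⊆ Icc 0 T ×ˢ {y | y ≠ 0} :=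
    prod_mono Ioo_subset_Icc_self le_rfl
  have hec : ContinuousOn (Function.uncurry e) (Icc 0 T ×ˢ univ) := by
    refine aux_cut_cont (Icc 0 T) (fun p => P p ^ 2 + ‖p.2‖ ^ 2 * ∑ i, Q i p ^ 2) ?_ φ hφc hφ0
    fun_prop
  have hP' := hP.mono hsub
  have hQ' := fun i => (hQ i).mono hsub
  have hec' : ContinuousOn (Function.uncurry e') (Ioo 0 T ×ˢ univ) := by
    refine aux_cut_cont (Ioo 0 T) (fun p => 2 * P p * DP p (1, 0)
      + ‖p.2‖ ^ 2 * ∑ i, 2 * Q i p * DQ i p (1, 0)) ?_ φ hφc hφ0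
    fun_prop
  have hecs : ∀ s ∈ Icc 0 T, Continuous (e s) := by
    intro s hs
    rw [← continuousOn_univ]
    exact hec.comp (f := fun y => (s, y)) (by fun_prop) (fun y _ => ⟨hs, trivial⟩)
  have hecs' : ∀ s ∈ Ioo 0 T, Continuous (e' s) := by
    intro s hs
    rw [← continuousOn_univ]
    exact hec'.comp (f := fun y => (s, y)) (by fun_prop) (fun y _ => ⟨hs, trivial⟩)
  have hK : IsCompact (Metric.closedBall (0 : EuclideanSpace ℝ (Fin d)) 2) :=
    isCompact_closedBall _ _
  have heK : ∀ s y, y ∉ Metric.closedBall (0 : EuclideanSpace ℝ (Fin d)) 2 → e s y = 0 :=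
    fun s y hy => by simp [he, hφK y hy]
  have heK' : ∀ s y, y ∉ Metric.closedBall (0 : EuclideanSpace ℝ (Fin d)) 2 → e' s y = 0 :=
    fun s y hy => by simp [he', hφK y hy]
  have hecomp : ∀ s, HasCompactSupport (e s) := fun s => HasCompactSupport.intro hK (heK s)
  -- time derivative of the density
  have hder : ∀ s ∈ Ioo 0 T, ∀ y, HasDerivAt (fun t => e t y) (e' s y) s := by
    intro s hs y
    by_cases hy : y = 0
    · subst hy
      simp only [he, he', hφ00, zero_mul]
      exact hasDerivAt_const _ _
    · have hp : (s, y) ∈ Ioo 0 T ×ˢ {y : EuclideanSpace ℝ (Fin d) | y ≠ 0} := ⟨hs, hy⟩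
      have hl : HasDerivAt (fun t : ℝ => (t, y)) ((1:ℝ), (0 : EuclideanSpace ℝ (Fin d))) s :=
        (hasDerivAt_id s).prodMk (hasDerivAt_const s y)
      have h1 : HasDerivAt (fun t => P (t, y)) (DP (s, y) (1, 0)) s :=
        (hDP _ hp).comp_hasDerivAt s hl
      have h2 : ∀ i, HasDerivAt (fun t => Q i (t, y)) (DQ i (s, y) (1, 0)) s :=
        fun i => (hDQ i _ hp).comp_hasDerivAt s hl
      have h3 : HasDerivAt (fun t => ∑ i, Q i (t, y) ^ 2)
          (∑ i, 2 * Q i (s, y) * DQ i (s, y) (1, 0)) s := by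
        apply HasDerivAt.fun_sum
        intro i _
        simpa using (h2 i).fun_pow 2
      have h4 := ((h1.fun_pow 2).fun_add (h3.const_mul (‖y‖ ^ 2))).const_mul (φ y)
      simpa [he, he'] using h4
  -- space divergence
  set H : Fin d → ℝ → EuclideanSpace ℝ (Fin d) → ℝ := fun i s y =>
    (φ y * ‖y‖ ^ 2) * (P (s, y) * Q i (s, y)) with hH
  obtain ⟨c, hc, hχ⟩ : ∃ c : EuclideanSpace ℝ (Fin d) → ℝ, Continuous c ∧ ∀ y,
      HasFDerivAt (fun y => φ y * ‖y‖ ^ 2) (c y • innerSL ℝ y) y := by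
    refine ⟨fun y => 2 * (deriv β (‖y‖ ^ 2) * ‖y‖ ^ 2 + β (‖y‖ ^ 2)), ?_, ?_⟩
    · have h1 : Continuous (deriv β) := hβ.continuous_deriv le_rfl
      have h2 := hβ.continuous
      fun_prop
    · intro y
      have h1 : HasFDerivAt (fun y : EuclideanSpace ℝ (Fin d) => ‖y‖ ^ 2)
        (2 • innerSL ℝ y) y := by
        simpa using (hasFDerivAt_id y).norm_sq
      have h2 : HasDerivAt (fun t => β t * t)
          (deriv β (‖y‖ ^ 2) * ‖y‖ ^ 2 + β (‖y‖ ^ 2) * 1) (‖y‖ ^ 2) :=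
        ((hβ.differentiable (by norm_num)) _).hasDerivAt.mul (hasDerivAt_id _)
      have h3 := h2.comp_hasFDerivAt y h1
      refine h3.congr_fderiv ?_
      ext v
      simp
      ring
  have hH0 : ∀ i s, H i s =ᶠ[nhds 0] fun _ => 0 := by
    intro i s
    filter_upwards [hφ0] with y hy
    simp [hH, hy]
  have hHd : ∀ i, ∀ s ∈ Ioo 0 T, ∀ y, y ≠ 0 → HasFDerivAt (H i s)
      ((φ y * ‖y‖ ^ 2) • (P (s, y) • (DQ i (s, y)).comp (ContinuousLinearMap.inr ℝ ℝ _)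
          + Q i (s, y) • (DP (s, y)).comp (ContinuousLinearMap.inr ℝ ℝ _))
        + (P (s, y) * Q i (s, y)) • (c y • innerSL ℝ y)) y := by
    intro i s hs y hy
    have hp : (s, y) ∈ Ioo 0 T ×ˢ {y : EuclideanSpace ℝ (Fin d) | y ≠ 0} := ⟨hs, hy⟩
    have hl : HasFDerivAt (fun z : EuclideanSpace ℝ (Fin d) => (s, z))
      (ContinuousLinearMap.inr ℝ ℝ _) y := hasFDerivAt_prodMk_right s y
    have h1 := (hDP _ hp).comp y hl
    have h2 := (hDQ i _ hp).comp y hl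
    exact (hχ y).mul (h1.mul h2)
  have hHdiff : ∀ i, ∀ s ∈ Ioo 0 T, Differentiable ℝ (H i s) := by
    intro i s hs y
    by_cases hy : y = 0
    · subst hy
      exact ((hasFDerivAt_const (0:ℝ) _).congr_of_eventuallyEq (hH0 i s)).differentiableAt
    · exact (hHd i s hs y hy).differentiableAt
  have hH0' : ∀ i s, ∀ v, (fun y => fderiv ℝ (H i s) y v) =ᶠ[nhds 0] fun _ => 0 := by
    intro i s v
    filter_upwards [(hH0 i s).fderiv (𝕜 := ℝ)] with y hy
    simp [hy]
  have hHc : ∀ i, ∀ s ∈ Ioo 0 T, ∀ v, Continuous fun y => fderiv ℝ (H i s) y v := by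
    intro i s hs v
    rw [continuous_iff_continuousAt]
    intro y
    by_cases hy : y = 0
    · subst hy
      exact continuousAt_const.congr (hH0' i s v).symm
    · have hm : {y : EuclideanSpace ℝ (Fin d) | y ≠ 0} ∈ nhds y := isOpen_ne.mem_nhds hy
      have hl : ContinuousOn (fun z : EuclideanSpace ℝ (Fin d) => (s, z)) {y | y ≠ 0} := by fun_prop
      have hmt : MapsTo (fun z : EuclideanSpace ℝ (Fin d) => (s, z)) {y | y ≠ 0}
        (Ioo 0 T ×ˢ {y | y ≠ 0}) := fun z hz => ⟨hs, hz⟩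
      have a1 := hP'.comp hl hmt
      have a2 := (hQ' i).comp hl hmt
      have a3 := hDPc.comp hl hmt
      have a4 := (hDQc i).comp hl hmt
      simp only [Function.comp_def] at a1 a2 a3 a4
      have : ContinuousOn (fun y => ((φ y * ‖y‖ ^ 2) •
          (P (s, y) • (DQ i (s, y)).comp (ContinuousLinearMap.inr ℝ ℝ _)
          + Q i (s, y) • (DP (s, y)).comp (ContinuousLinearMap.inr ℝ ℝ _))
        + (P (s, y) * Q i (s, y)) • (c y • innerSL ℝ y)) v) {y | y ≠ 0} := by
        simp only [add_apply, smul_apply,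
          ContinuousLinearMap.comp_apply, innerSL_apply_apply]
        exact ((hφc.mul (by fun_prop)).continuousOn.smul
          ((a1.smul (a4.clm_apply continuousOn_const)).add
            (a2.smul (a3.clm_apply continuousOn_const)))).add
          ((a1.mul a2).smul (hc.continuousOn.smul (by fun_prop)))
      refine (this.continuousAt hm).congr ?_
      filter_upwards [hm] with z hz
      rw [(hHd i s hs z hz).fderiv]
  have hident : ∀ s ∈ Ioo 0 T, ∀ y,
      e' s y = ∑ i, 2 * fderiv ℝ (H i s) y (EuclideanSpace.single i 1) := by
    intro s hs y
    by_cases hy : y = 0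
    · subst hy
      have := fun i => (hH0' i s (EuclideanSpace.single i 1)).self_of_nhds
      simp only at this
      simp [he', hφ00, this]
    · have hp : (s, y) ∈ Ioo 0 T ×ˢ {y : EuclideanSpace ℝ (Fin d) | y ≠ 0} := ⟨hs, hy⟩
      have e1 := hE _ hp
      have e2 := hw _ hp
      have e3 := fun i => hsym i _ hp
      simp only at e1 e2
      have e4 : ∀ i, fderiv ℝ (H i s) y (EuclideanSpace.single i 1) =
          φ y * ‖y‖ ^ 2 * (P (s, y) * DQ i (s, y) (0, EuclideanSpace.single i 1)
            + Q i (s, y) * DP (s, y) (0, EuclideanSpace.single i 1))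
            + P (s, y) * c y * (y i * Q i (s, y)) := by
        intro i
        rw [(hHd i s hs y hy).fderiv]
        simp [EuclideanSpace.inner_single_right]
        ring
      simp only [he', e4, e3, e2]
      simp only [mul_add, Finset.sum_add_distrib, Finset.mul_sum]
      have e5 : ∑ i, 2 * (P (s, y) * c y * (y i * Q i (s, y))) = 0 := by
        rw [← Finset.mul_sum, ← Finset.mul_sum, e1, mul_zero, mul_zero]
      rw [e5, add_zero]
      congr 1 <;> refine Finset.sum_congr rfl fun i _ => ?_ <;> ring
  have hint0 : ∀ s ∈ Ioo 0 T, ∫ y, e' s y = 0 := by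
    intro s hs
    have hcs : ∀ i, HasCompactSupport (H i s) := fun i =>
      HasCompactSupport.intro hK (fun y hy => by simp [hH, hφK y hy])
    simp_rw [hident s hs]
    rw [MeasureTheory.integral_finsetSum]
    · apply Finset.sum_eq_zero
      intro i _
      rw [MeasureTheory.integral_const_mul,
        aux_integral_fderiv (H i s) (hHdiff i s hs) (hcs i) _ (hHc i s hs _), mul_zero]
    · intro i _
      exact ((hHc i s hs _).integrable_of_hasCompactSupport
        ((hcs i).fderiv_apply ℝ _)).const_mul 2
  have hEder : ∀ s ∈ Ioo 0 T, HasDerivAt (fun t => ∫ y, e t y) 0 s := by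
    intro s hs
    obtain ⟨δ, hδ, hδs⟩ := Metric.nhds_basis_closedBall.mem_iff.1 (isOpen_Ioo.mem_nhds hs)
    obtain ⟨C, hC⟩ := ((isCompact_closedBall s δ).prod hK).exists_bound_of_continuousOn
      (hec'.mono (prod_mono hδs (subset_univ _)))
    have := (hasDerivAt_integral_of_dominated_loc_of_deriv_le
      (μ := (MeasureTheory.volume : MeasureTheory.Measure (EuclideanSpace ℝ (Fin d))))
      (F := e) (F' := e') (x₀ := s) (s := Metric.closedBall s δ)
      (bound := (Metric.closedBall (0 : EuclideanSpace ℝ (Fin d)) 2).indicator fun _ => C)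
      (Metric.closedBall_mem_nhds s hδ) ?_
      ((hecs s (Ioo_subset_Icc_self hs)).integrable_of_hasCompactSupport (hecomp s))
      (hecs' s hs).aestronglyMeasurable ?_ ?_ ?_).2
    · rwa [hint0 s hs] at this
    · filter_upwards [isOpen_Ioo.mem_nhds hs] with t ht
      exact (hecs t (Ioo_subset_Icc_self ht)).aestronglyMeasurable
    · refine Filter.Eventually.of_forall fun y t ht => ?_
      by_cases hy : y ∈ Metric.closedBall (0 : EuclideanSpace ℝ (Fin d)) 2
      · rw [indicator_of_mem hy]
        exact hC (t, y) ⟨ht, hy⟩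
      · rw [indicator_of_notMem hy, heK' t y hy, norm_zero]
    · rw [MeasureTheory.integrable_indicator_iff hK.measurableSet]
      exact MeasureTheory.integrableOn_const hK.measure_lt_top.ne
    · exact Filter.Eventually.of_forall fun y t ht => hder t (hδs ht) y
  have hEc : ContinuousOn (fun t => ∫ y, e t y) (Icc 0 T) :=
    continuousOn_integral_of_compact_support hK hec (fun s y _ hy => heK s y hy)
  have hE0 : ∫ y, e 0 y = 0 := by
    have : ∀ y, e 0 y = 0 := by
      intro y
      by_cases hy : y = 0
      · subst hy; simp [he, hφ00]
      · simp [he, hP0 y hy, fun i => hQ0 i y hy]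
    simp [this]
  intro s hs y hy
  have hy0 : y ≠ 0 := by rintro rfl; simp at hy
  have hEs : ∫ y, e s y = 0 := by
    rcases hs.1.eq_or_lt with h | h
    · rw [← h]; exact hE0
    · obtain ⟨c, -, hc⟩ := exists_hasDerivAt_eq_slope (fun t => ∫ y, e t y) (fun _ => 0) h
        (hEc.mono (Icc_subset_Icc_right hs.2)) (fun x hx => hEder x ⟨hx.1, hx.2.trans_le hs.2⟩)
      have h2 : s - 0 ≠ 0 := by simpa using h.ne'
      rw [eq_comm, div_eq_zero_iff] at hc
      rcases hc with hc | hc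
      · simp only [hE0, sub_zero] at hc; exact hc
      · exact absurd hc h2
  have henn : ∀ z, 0 ≤ e s z := by
    intro z
    have : 0 ≤ φ z := hβn _
    simp only [he]
    positivity
  have hes : e s y = 0 := by
    by_contra hne
    exact (Continuous.integral_pos_of_hasCompactSupport_nonneg_nonzero (hecs s hs) (hecomp s)
      henn hne).ne' hEs
  have hq : 0 ≤ ∑ i, Q i (s, y) ^ 2 := Finset.sum_nonneg fun i _ => sq_nonneg _
  simp only [he, hφ, hy, one_pow, hβ1, one_mul] at hes
  nlinarith [sq_nonneg (P (s, y))]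
lemma aux_open {E : Type*} [NormedAddCommGroup E] (a b : ℝ) :
    IsOpen (Ioo a b ×ˢ {y : E | y ≠ 0}) := isOpen_Ioo.prod isOpen_ne

lemma aux_unique {d : ℕ} (T : ℝ) (hT : 0 < T) (F : ℝ × EuclideanSpace ℝ (Fin d) → ℝ)
    (hF : ContDiffOn ℝ 2 F (Icc 0 T ×ˢ {y | y ≠ 0}))
    (hom : ∀ s, ∀ c : ℝ, 0 < c → ∀ y, F (s, c • y) = F (s, y))
    (h0 : ∀ y, F (0, y) = 0)
    (ht : ∀ y, y ≠ 0 → HasDerivWithinAt (fun s => F (s, y)) 0 (Icc 0 T) 0)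
    (hw : ∀ p ∈ Ioo 0 T ×ˢ {y | y ≠ 0}, fderiv ℝ (fderiv ℝ F) p (1, 0) (1, 0) =
      ‖p.2‖ ^ 2 * ∑ i, fderiv ℝ (fderiv ℝ F) p (0, EuclideanSpace.single i 1)
        (0, EuclideanSpace.single i 1)) :
    ∀ s ∈ Icc 0 T, ∀ y, ‖y‖ = 1 → F (s, y) = 0 := by
  set S : Set (ℝ × EuclideanSpace ℝ (Fin d)) := Icc 0 T ×ˢ {y | y ≠ 0} with hS
  set U : Set (ℝ × EuclideanSpace ℝ (Fin d)) := Ioo 0 T ×ˢ {y | y ≠ 0} with hU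
  have hUo : IsOpen U := aux_open 0 T
  have hUS : U ⊆ S := prod_mono Ioo_subset_Icc_self le_rfl
  have hSu : UniqueDiffOn ℝ S := (uniqueDiffOn_Icc hT).prod isOpen_ne.uniqueDiffOn
  set G := fderivWithin ℝ F S with hG
  have hGc : ContDiffOn ℝ 1 G S := hF.fderivWithin hSu (by norm_num)
  have hFU : ContDiffOn ℝ 2 F U := hF.mono hUS
  have hFat : ∀ p ∈ U, ContDiffAt ℝ 2 F p := fun p hp => hFU.contDiffAt (hUo.mem_nhds hp)
  have hGe : ∀ p ∈ U, G p = fderiv ℝ F p := fun p hp =>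
    fderivWithin_of_mem_nhds (Filter.mem_of_superset (hUo.mem_nhds hp) hUS)
  have hGee : ∀ p ∈ U, G =ᶠ[nhds p] fderiv ℝ F := fun p hp =>
    Filter.eventuallyEq_of_mem (hUo.mem_nhds hp) hGe
  have hDF : ContDiffOn ℝ 1 (fderiv ℝ F) U := hFU.fderiv_of_isOpen hUo (by norm_num)
  have hDDF : ContinuousOn (fderiv ℝ (fderiv ℝ F)) U :=
    hDF.continuousOn_fderiv_of_isOpen hUo (by norm_num)
  have hDG : ∀ p ∈ U, HasFDerivAt G (fderiv ℝ (fderiv ℝ F) p) p := by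
    intro p hp
    have h1 : DifferentiableAt ℝ (fderiv ℝ F) p :=
      (hDF.contDiffAt (hUo.mem_nhds hp)).differentiableAt (by norm_num)
    exact h1.hasFDerivAt.congr_of_eventuallyEq (hGee p hp)
  have hGF : ∀ p ∈ S, HasFDerivWithinAt F (G p) S p := fun p hp =>
    ((hF p hp).differentiableWithinAt (by norm_num)).hasFDerivWithinAt
  have happ : ∀ v, ∀ p ∈ U, HasFDerivAt (fun p => G p v) ((fderiv ℝ (fderiv ℝ F) p).flip v) p := by
    intro v p hp
    have := (hDG p hp).clm_apply (hasFDerivAt_const v p)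
    refine this.congr_fderiv ?_
    ext <;> simp
  have key : ∀ s ∈ Icc 0 T, ∀ y, ‖y‖ = 1 → G (s, y) (1, 0) = 0 := by
    refine aux_energy T hT (fun p => G p (1, 0))
      (fun i p => G p (0, EuclideanSpace.single i 1))
      (fun p => (fderiv ℝ (fderiv ℝ F) p).flip (1, 0))
      (fun i p => (fderiv ℝ (fderiv ℝ F) p).flip (0, EuclideanSpace.single i 1))
      ?_ ?_ ?_ ?_ ?_ ?_ ?_ ?_ ?_ ?_ ?_
    · exact hGc.continuousOn.clm_apply continuousOn_const
    · intro i
      exact hGc.continuousOn.clm_apply continuousOn_const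
    · have := (ContinuousLinearMap.flipₗᵢ ℝ (ℝ × EuclideanSpace ℝ (Fin d))
        (ℝ × EuclideanSpace ℝ (Fin d)) ℝ).continuous.comp_continuousOn hDDF
      exact this.clm_apply continuousOn_const
    · intro i
      have := (ContinuousLinearMap.flipₗᵢ ℝ (ℝ × EuclideanSpace ℝ (Fin d))
        (ℝ × EuclideanSpace ℝ (Fin d)) ℝ).continuous.comp_continuousOn hDDF
      exact this.clm_apply continuousOn_const
    · exact happ _
    · intro i
      exact happ _
    · intro i p hp
      have := (hFat p hp).isSymmSndFDerivAt (by simp)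
      simp only [ContinuousLinearMap.flip_apply]
      exact this _ _
    · intro p hp
      simpa using hw p hp
    · rintro ⟨s, y⟩ hp
      have h1 : ∑ i, y i * G (s, y) (0, EuclideanSpace.single i 1) = G (s, y) (0, y) := by
        have h2 : ((0:ℝ), y) = ∑ i, y i • ((0:ℝ), (EuclideanSpace.single i (1:ℝ))) := by
          refine Prod.ext ?_ ?_
          · simp [Prod.fst_sum]
          · simp only [Prod.snd_sum, Prod.smul_snd]
            ext j
            simp [Pi.single_apply]
        conv_rhs => rw [h2, map_sum]
        simp only [map_smul, smul_eq_mul]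
      change ∑ i, y i * G (s, y) (0, EuclideanSpace.single i 1) = 0
      rw [h1, hGe _ hp]
      have hd : HasFDerivAt F (fderiv ℝ F (s, y)) (s, (1:ℝ) • y) := by
        rw [one_smul]
        exact ((hFat _ hp).differentiableAt (by norm_num)).hasFDerivAt
      have hl : HasDerivAt (fun c : ℝ => (s, c • y)) ((0:ℝ), y) 1 := by
        simpa using (hasDerivAt_const (1:ℝ) s).prodMk ((hasDerivAt_id (1:ℝ)).smul_const y)
      have h3 := hd.comp_hasDerivAt (1:ℝ) hl
      have h4 : HasDerivAt (F ∘ fun c : ℝ => (s, c • y)) 0 1 := by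
        refine (hasDerivAt_const (1:ℝ) (F (s, y))).congr_of_eventuallyEq ?_
        filter_upwards [lt_mem_nhds (zero_lt_one (α := ℝ))] with c hc
        exact hom s c hc y
      exact h3.unique h4
    · intro y hy
      have hl : HasDerivWithinAt (fun t : ℝ => (t, y)) ((1:ℝ), (0 : EuclideanSpace ℝ (Fin d)))
        (Icc 0 T) 0 := (hasDerivWithinAt_id 0 _).prodMk (hasDerivWithinAt_const _ _ y)
      have hmt : MapsTo (fun t : ℝ => (t, y)) (Icc 0 T) S := fun t h => ⟨h, hy⟩
      have h1 := (hGF (0, y) ⟨⟨le_rfl, hT.le⟩, hy⟩).comp_hasDerivWithinAt (0:ℝ) hl hmt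
      exact (uniqueDiffOn_Icc hT 0 ⟨le_rfl, hT.le⟩).eq_deriv _ h1 (ht y hy)
    · intro i y hy
      have hl : HasFDerivAt (fun z : EuclideanSpace ℝ (Fin d) => ((0:ℝ), z))
        (ContinuousLinearMap.inr ℝ ℝ _) y := hasFDerivAt_prodMk_right 0 y
      have h1 := (hGF (0, y) ⟨⟨le_rfl, hT.le⟩, hy⟩).comp y
        (hl.hasFDerivWithinAt (s := {y | y ≠ 0})) (fun t h => ⟨⟨le_rfl, hT.le⟩, h⟩)
      have h2 := h1.hasFDerivAt (isOpen_ne.mem_nhds hy)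
      have h3 : HasFDerivAt (𝕜 := ℝ) (F ∘ fun z : EuclideanSpace ℝ (Fin d) => ((0:ℝ), z))
          (0 : EuclideanSpace ℝ (Fin d) →L[ℝ] ℝ) y := by
        have : (F ∘ fun z : EuclideanSpace ℝ (Fin d) => ((0:ℝ), z)) = fun _ => 0 := by
          ext z; exact h0 z
        rw [this]; exact hasFDerivAt_const _ _
      have h4 := congrArg (fun L : EuclideanSpace ℝ (Fin d) →L[ℝ] ℝ => L (EuclideanSpace.single i (1:ℝ))) (h2.unique h3)
      simpa using h4
  intro s hs y hy
  have hy0 : y ≠ 0 := by rintro rfl; simp at hy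
  have hd : ∀ t ∈ Icc 0 T, HasDerivWithinAt (fun t => F (t, y)) 0 (Icc 0 T) t := by
    intro t ht
    have hl : HasDerivWithinAt (fun t : ℝ => (t, y)) ((1:ℝ), (0 : EuclideanSpace ℝ (Fin d)))
      (Icc 0 T) t := (hasDerivWithinAt_id t _).prodMk (hasDerivWithinAt_const _ _ y)
    have hmt : MapsTo (fun t : ℝ => (t, y)) (Icc 0 T) S := fun t h => ⟨h, hy0⟩
    have h1 := (hGF (t, y) ⟨ht, hy0⟩).comp_hasDerivWithinAt t hl hmt
    rwa [key t ht y hy] at h1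
  have h2 := (convex_Icc 0 T).norm_image_sub_le_of_norm_hasDerivWithin_le (C := 0)
    hd (fun t _ => by simp) ⟨le_rfl, hT.le⟩ hs
  simp only [h0, sub_zero, zero_mul] at h2
  simpa using h2

lemma aux_ext_smul {d : ℕ} (g : Metric.sphere (0 : EuclideanSpace ℝ (Fin d)) 1 → ℝ) (c : ℝ)
    (hc : 0 < c) (y : EuclideanSpace ℝ (Fin d)) : extSd d g (c • y) = extSd d g y := by
  unfold extSd
  by_cases hy : y = 0
  · simp [hy]
  · have : c • y ≠ 0 := smul_ne_zero hc.ne' hy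
    rw [dif_neg this, dif_neg hy]
    congr 2
    rw [norm_smul, Real.norm_of_nonneg hc.le, smul_smul]
    congr 1
    field_simp

lemma aux_ext_unit {d : ℕ} (g : Metric.sphere (0 : EuclideanSpace ℝ (Fin d)) 1 → ℝ)
    (x : Metric.sphere (0 : EuclideanSpace ℝ (Fin d)) 1) : extSd d g x = g x := by
  have hx : ‖(x : EuclideanSpace ℝ (Fin d))‖ = 1 := by simp
  have hx0 : (x : EuclideanSpace ℝ (Fin d)) ≠ 0 := by
    intro h; rw [h] at hx; simp at hx
  unfold extSd
  rw [dif_neg hx0]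
  congr 1
  ext1
  simp [hx]

lemma aux_sdd_smul {d : ℕ} (f : EuclideanSpace ℝ (Fin d) → ℝ) (c : ℝ) (hc : 0 < c)
    (hf : ∀ y, f (c • y) = f y) (y v : EuclideanSpace ℝ (Fin d)) :
    sddR d f y v = c ^ 2 * sddR d f (c • y) v := by
  have h1 : ∀ y, fderiv ℝ f y = c • fderiv ℝ f (c • y) := by
    intro y
    rw [← fderiv_comp_smul]
    simp only [hf]
  unfold sddR
  have h2 : (fun y => fderiv ℝ f y v) = fun y => c • (fun z => fderiv ℝ f z v) (c • y) := by
    ext y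
    rw [h1 y]; rfl
  conv_lhs => rw [h2]
  have h3 : fderiv ℝ (fun y => c • (fun z => fderiv ℝ f z v) (c • y)) y
      = c • fderiv ℝ (fun y => (fun z => fderiv ℝ f z v) (c • y)) y := by
    let _ := invertibleOfNonzero hc.ne'
    exact fderiv_const_smul_of_invertible c
  rw [h3, fderiv_comp_smul (f := fun z => fderiv ℝ f z v)]
  simp
  ring

lemma aux_wave {d : ℕ} (T : ℝ) (u : ℝ → Metric.sphere (0 : EuclideanSpace ℝ (Fin d)) 1 → ℝ)
    (V : ℝ × EuclideanSpace ℝ (Fin d) → ℝ) (hV : V = fun p => extSd d (u p.1) p.2)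
    (hreg : ContDiffOn ℝ 2 V (Ioo 0 T ×ˢ {y | y ≠ 0}))
    (hw : ∀ r ∈ Ioo 0 T, ∀ x, deriv (deriv fun s => u s x) r = lapSd d (u r) x) :
    ∀ p ∈ Ioo 0 T ×ˢ {y | y ≠ 0}, fderiv ℝ (fderiv ℝ V) p (1, 0) (1, 0) =
      ‖p.2‖ ^ 2 * ∑ i, fderiv ℝ (fderiv ℝ V) p (0, EuclideanSpace.single i 1)
        (0, EuclideanSpace.single i 1) := by
  rintro ⟨s, y⟩ hp
  have hs : s ∈ Ioo 0 T := hp.1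
  have hy : y ≠ 0 := hp.2
  have hUo : IsOpen (Ioo 0 T ×ˢ {y : EuclideanSpace ℝ (Fin d) | y ≠ 0}) := aux_open 0 T
  have hd : ∀ q ∈ Ioo 0 T ×ˢ {y : EuclideanSpace ℝ (Fin d) | y ≠ 0},
      HasFDerivAt V (fderiv ℝ V q) q := fun q hq =>
    ((hreg.contDiffAt (hUo.mem_nhds hq)).differentiableAt (by norm_num)).hasFDerivAt
  have hDF := hreg.fderiv_of_isOpen (m := 1) hUo (by norm_num)
  have hdd : HasFDerivAt (fderiv ℝ V) (fderiv ℝ (fderiv ℝ V) (s, y)) (s, y) :=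
    ((hDF.contDiffAt (hUo.mem_nhds hp)).differentiableAt (by norm_num)).hasFDerivAt
  have hlt : ∀ t : ℝ, ∀ y : EuclideanSpace ℝ (Fin d),
      HasDerivAt (fun t : ℝ => (t, y)) ((1:ℝ), (0 : EuclideanSpace ℝ (Fin d))) t :=
    fun t y => (hasDerivAt_id t).prodMk (hasDerivAt_const t y)
  have hly : ∀ y, HasFDerivAt (fun z : EuclideanSpace ℝ (Fin d) => (s, z))
      (ContinuousLinearMap.inr ℝ ℝ _) y := fun y => hasFDerivAt_prodMk_right s y
  have hpos : 0 < ‖y‖ := norm_pos_iff.2 hy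
  let x : Metric.sphere (0 : EuclideanSpace ℝ (Fin d)) 1 := ⟨‖y‖⁻¹ • y, by
    rw [mem_sphere_zero_iff_norm, norm_smul, norm_inv, norm_norm,
      inv_mul_cancel₀ (norm_ne_zero_iff.mpr hy)]⟩
  -- time
  have ht : fderiv ℝ (fderiv ℝ V) (s, y) (1, 0) (1, 0) = deriv (deriv fun t => u t x) s := by
    have e0 : (fun t => u t x) = fun t => V (t, y) := by
      ext t
      simp [hV, extSd, hy, x]
    rw [e0]
    have e1 : deriv (fun t => V (t, y)) =ᶠ[nhds s] fun t => fderiv ℝ V (t, y) (1, 0) := by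
      filter_upwards [isOpen_Ioo.mem_nhds hs] with t ht
      exact ((hd (t, y) ⟨ht, hy⟩).comp_hasDerivAt t (hlt t y)).deriv
    rw [e1.deriv_eq]
    have h1 : HasDerivAt (fun t => fderiv ℝ V (t, y)) (fderiv ℝ (fderiv ℝ V) (s, y) (1, 0)) s :=
      hdd.comp_hasDerivAt s (hlt s y)
    have h2 := h1.clm_apply (hasDerivAt_const s ((1:ℝ), (0 : EuclideanSpace ℝ (Fin d))))
    rw [h2.deriv]
    simp
  have hsp : ∀ v, fderiv ℝ (fderiv ℝ V) (s, y) (0, v) (0, v) = sddR d (extSd d (u s)) y v := by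
    intro v
    have e0 : extSd d (u s) = fun z => V (s, z) := by
      ext z; simp [hV]
    rw [e0]
    unfold sddR
    have e1 : (fun z => fderiv ℝ (fun z => V (s, z)) z v) =ᶠ[nhds y]
        fun z => fderiv ℝ V (s, z) (0, v) := by
      filter_upwards [isOpen_ne.mem_nhds hy] with z hz
      have := ((hd (s, z) ⟨hs, hz⟩).comp z (hly z)).fderiv
      simp only [Function.comp_def] at this
      rw [this]; simp
    rw [e1.fderiv_eq]
    have h1 := hdd.comp y (hly y)
    have h2 := h1.clm_apply (hasFDerivAt_const ((0:ℝ), v) y)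
    simp only [Function.comp_def] at h2
    rw [h2.fderiv]
    simp
  rw [ht, hw s hs x]
  simp only [hsp]
  unfold lapSd
  rw [Finset.mul_sum]
  refine Finset.sum_congr rfl fun i _ => ?_
  rw [aux_sdd_smul (extSd d (u s)) ‖y‖⁻¹ (inv_pos.2 hpos)
    (fun z => aux_ext_smul _ _ (inv_pos.2 hpos) z) y]
  simp only [x]
  field_simp

open Pointwise in
lemma aux_vadd (a b : ℝ) : (a + b) +ᵥ -Iic b = Ici a := by
  ext z
  rw [mem_vadd_set_iff_neg_vadd_mem]
  simp only [mem_neg, mem_Iic, mem_Ici, vadd_eq_add]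
  constructor <;> intro h <;> linarith

/-- Superlensing via the complementary property. In radial–spherical coordinates
`x = r x̂`, the equation `div(A^H∇u) = 0` for
`A^H = ± (r^{1-d} e_r ⊗ e_r - r^{3-d}(I - e_r ⊗ e_r))` on the two subannuli reads
`± r^{1-d}(∂²_rr u - Δ_{S^{d-1}} u) = 0`, and the transmission conditions `[u] = 0`,
`[A^H∇u·e_r] = 0` across `r = r_m` amount to continuity of `u` (automatic here) and the
sign flip `∂_r u(r_m⁺,·) = -∂_r u(r_m⁻,·)`.  Then `u(r₂ x̂) = u(r₁ x̂)` and
`∂_r u(r₂ x̂) = -∂_r u(r₁ x̂)` for every unit vector `x̂`. -/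
theorem stmt19 (d : ℕ) (hd : d = 2 ∨ d = 3) (r₁ r₂ r_m : ℝ) (h1 : 0 < r₁)
    (h12 : r₁ < r₂) (hm : r_m = (r₁ + r₂) / 2)
    (u : ℝ → Metric.sphere (0 : EuclideanSpace ℝ (Fin d)) 1 → ℝ)
    (hreg₁ : ContDiffOn ℝ 2 (fun p : ℝ × EuclideanSpace ℝ (Fin d) => extSd d (u p.1) p.2)
      (Icc r₁ r_m ×ˢ {y : EuclideanSpace ℝ (Fin d) | y ≠ 0}))
    (hreg₂ : ContDiffOn ℝ 2 (fun p : ℝ × EuclideanSpace ℝ (Fin d) => extSd d (u p.1) p.2)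
      (Icc r_m r₂ ×ˢ {y : EuclideanSpace ℝ (Fin d) | y ≠ 0}))
    (hwave₂ : ∀ r ∈ Ioo r_m r₂, ∀ x : Metric.sphere (0 : EuclideanSpace ℝ (Fin d)) 1,
      deriv (deriv fun s => u s x) r - lapSd d (u r) x = 0)
    (hwave₁ : ∀ r ∈ Ioo r₁ r_m, ∀ x : Metric.sphere (0 : EuclideanSpace ℝ (Fin d)) 1,
      -(deriv (deriv fun s => u s x) r) + lapSd d (u r) x = 0)
    (hflux : ∀ x : Metric.sphere (0 : EuclideanSpace ℝ (Fin d)) 1,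
      derivWithin (fun r => u r x) (Ici r_m) r_m =
        - derivWithin (fun r => u r x) (Iic r_m) r_m) :
    (∀ x : Metric.sphere (0 : EuclideanSpace ℝ (Fin d)) 1, u r₂ x = u r₁ x) ∧
    (∀ x : Metric.sphere (0 : EuclideanSpace ℝ (Fin d)) 1,
      derivWithin (fun r => u r x) (Iic r₂) r₂ =
        - derivWithin (fun r => u r x) (Ici r₁) r₁) := by
  have hT : 0 < (r₂ - r₁) / 2 := by linarith
  set T := (r₂ - r₁) / 2 with hTd
  have hr2 : r_m + T = r₂ := by rw [hm, hTd]; ring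
  have hr1 : r_m - T = r₁ := by rw [hm, hTd]; ring
  have hx0 : ∀ x : Metric.sphere (0 : EuclideanSpace ℝ (Fin d)) 1,
      (x : EuclideanSpace ℝ (Fin d)) ≠ 0 := by
    intro x h
    have hx : ‖(x : EuclideanSpace ℝ (Fin d))‖ = 1 := by simp
    rw [h] at hx; simp at hx
  set Vp : ℝ × EuclideanSpace ℝ (Fin d) → ℝ := fun p => extSd d (u (r_m + p.1)) p.2 with hVp
  set Vm : ℝ × EuclideanSpace ℝ (Fin d) → ℝ := fun p => extSd d (u (r_m - p.1)) p.2 with hVm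
  have cVp : ContDiffOn ℝ 2 Vp (Icc 0 T ×ˢ {y | y ≠ 0}) := by
    refine hreg₂.comp (g := fun p : ℝ × EuclideanSpace ℝ (Fin d) => extSd d (u p.1) p.2)
      (f := fun p : ℝ × EuclideanSpace ℝ (Fin d) => (r_m + p.1, p.2)) (by fun_prop) ?_
    rintro ⟨s, y⟩ ⟨hs, hy⟩
    exact ⟨⟨by simpa using hs.1, by simpa [← hr2] using hs.2⟩, hy⟩
  have cVm : ContDiffOn ℝ 2 Vm (Icc 0 T ×ˢ {y | y ≠ 0}) := by
    refine hreg₁.comp (g := fun p : ℝ × EuclideanSpace ℝ (Fin d) => extSd d (u p.1) p.2)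
      (f := fun p : ℝ × EuclideanSpace ℝ (Fin d) => (r_m - p.1, p.2)) (by fun_prop) ?_
    rintro ⟨s, y⟩ ⟨hs, hy⟩
    exact ⟨⟨by have := hs.2; simp only at this ⊢; linarith, by simpa using hs.1⟩, hy⟩
  have hsub : (Ioo 0 T ×ˢ {y : EuclideanSpace ℝ (Fin d) | y ≠ 0}) ⊆ Icc 0 T ×ˢ {y | y ≠ 0} :=
    prod_mono Ioo_subset_Icc_self le_rfl
  have wp := aux_wave T (fun s => u (r_m + s)) Vp rfl (cVp.mono hsub) (by
    intro r hr x
    have h := hwave₂ (r_m + r) ⟨by linarith [hr.1], by linarith [hr.2]⟩ x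
    have e1 : (deriv fun s => u (r_m + s) x) = fun s => deriv (fun s => u s x) (r_m + s) := by
      ext s; exact deriv_comp_const_add (fun s => u s x) r_m s
    rw [e1, deriv_comp_const_add]
    linarith)
  have wm := aux_wave T (fun s => u (r_m - s)) Vm rfl (cVm.mono hsub) (by
    intro r hr x
    have h := hwave₁ (r_m - r) ⟨by linarith [hr.2], by linarith [hr.1]⟩ x
    have e1 : (deriv fun s => u (r_m - s) x) = fun s => -deriv (fun s => u s x) (r_m - s) := by
      ext s; exact deriv_comp_const_sub (fun s => u s x) r_m s
    rw [e1, deriv.fun_neg, deriv_comp_const_sub (deriv fun s => u s x)]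
    linarith)
  have hUo : IsOpen (Ioo 0 T ×ˢ {y : EuclideanSpace ℝ (Fin d) | y ≠ 0}) := aux_open 0 T
  have main := aux_unique T hT (fun p => Vp p - Vm p) (cVp.sub cVm) ?_ ?_ ?_ ?_
  rotate_left
  · intro s c hc y
    simp only [hVp, hVm, aux_ext_smul _ c hc]
  · intro y
    simp [hVp, hVm]
  · intro y hy
    have hpos : 0 < ‖y‖ := norm_pos_iff.2 hy
    let x : Metric.sphere (0 : EuclideanSpace ℝ (Fin d)) 1 := ⟨‖y‖⁻¹ • y, by
      rw [mem_sphere_zero_iff_norm, norm_smul, norm_inv, norm_norm,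
        inv_mul_cancel₀ (norm_ne_zero_iff.mpr hy)]⟩
    have ex : ∀ r, extSd d (u r) y = u r x := by
      intro r; simp [extSd, hy, x]
    simp only [hVp, hVm, ex]
    have d2 : DifferentiableWithinAt ℝ (fun r => u r x) (Ici r_m) r_m := by
      have h := (hreg₂.differentiableOn (by norm_num)).comp (f := fun r : ℝ => (r, y))
        (s := Icc r_m r₂) (by fun_prop) (fun r hr => ⟨hr, hy⟩)
      simp only [Function.comp_def, ex] at h
      exact (h r_m ⟨le_rfl, by linarith⟩).mono_of_mem_nhdsWithin
        (Icc_mem_nhdsGE (by linarith))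
    have d1 : DifferentiableWithinAt ℝ (fun r => u r x) (Iic r_m) r_m := by
      have h := (hreg₁.differentiableOn (by norm_num)).comp (f := fun r : ℝ => (r, y))
        (s := Icc r₁ r_m) (by fun_prop) (fun r hr => ⟨hr, hy⟩)
      simp only [Function.comp_def, ex] at h
      exact (h r_m ⟨by linarith, le_rfl⟩).mono_of_mem_nhdsWithin
        (Icc_mem_nhdsLE (by linarith))
    have g2 := d2.hasDerivWithinAt
    have g1 := d1.hasDerivWithinAt
    rw [hflux x] at g2
    have k2 : HasDerivWithinAt (fun s => u (r_m + s) x)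
        (- derivWithin (fun r => u r x) (Iic r_m) r_m) (Icc 0 T) 0 := by
      have hl : HasDerivWithinAt (fun s : ℝ => r_m + s) 1 (Icc 0 T) 0 :=
        (hasDerivWithinAt_id _ _).const_add r_m
      have := HasDerivWithinAt.comp_of_eq (h₂ := fun r => u r x) (0:ℝ) g2 hl
        (fun s hs => by simpa using hs.1) (by simp)
      simpa [Function.comp_def] using this
    have k1 : HasDerivWithinAt (fun s => u (r_m - s) x)
        (- derivWithin (fun r => u r x) (Iic r_m) r_m) (Icc 0 T) 0 := by
      have hl : HasDerivWithinAt (fun s : ℝ => r_m - s) (-1) (Icc 0 T) 0 :=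
        (hasDerivWithinAt_id _ _).const_sub r_m
      have := HasDerivWithinAt.comp_of_eq (h₂ := fun r => u r x) (0:ℝ) g1 hl
        (fun s hs => by simpa using hs.1) (by simp)
      simpa [Function.comp_def] using this
    simpa using k2.fun_sub k1
  · intro p hp
    have hc2 : ∀ V : ℝ × EuclideanSpace ℝ (Fin d) → ℝ,
        ContDiffOn ℝ 2 V (Icc 0 T ×ˢ {y | y ≠ 0}) →
        (∀ q ∈ Ioo 0 T ×ˢ {y : EuclideanSpace ℝ (Fin d) | y ≠ 0}, DifferentiableAt ℝ V q) ∧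
        DifferentiableAt ℝ (fderiv ℝ V) p := by
      intro V hV
      have hreg := hV.mono hsub
      have hDF := hreg.fderiv_of_isOpen (m := 1) hUo (by norm_num)
      exact ⟨fun q hq => (hreg.contDiffAt (hUo.mem_nhds hq)).differentiableAt (by norm_num),
        (hDF.contDiffAt (hUo.mem_nhds hp)).differentiableAt (by norm_num)⟩
    have e1 : fderiv ℝ (fun p => Vp p - Vm p) =ᶠ[nhds p] fun q => fderiv ℝ Vp q - fderiv ℝ Vm q := by
      filter_upwards [hUo.mem_nhds hp] with q hq
      exact fderiv_fun_sub ((hc2 Vp cVp).1 q hq) ((hc2 Vm cVm).1 q hq)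
    have e2 : fderiv ℝ (fderiv ℝ (fun p => Vp p - Vm p)) p =
        fderiv ℝ (fderiv ℝ Vp) p - fderiv ℝ (fderiv ℝ Vm) p := by
      rw [e1.fderiv_eq]
      exact fderiv_fun_sub (hc2 Vp cVp).2 (hc2 Vm cVm).2
    rw [e2]
    simp only [sub_apply, Finset.sum_sub_distrib, mul_sub]
    rw [wp p hp, wm p hp]
  have hrefl : ∀ x : Metric.sphere (0 : EuclideanSpace ℝ (Fin d)) 1, ∀ s ∈ Icc 0 T,
      u (r_m + s) x = u (r_m - s) x := by
    intro x s hs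
    have := main s hs x (by simp)
    simp only [hVp, hVm, aux_ext_unit] at this
    linarith
  refine ⟨fun x => ?_, fun x => ?_⟩
  · have := hrefl x T ⟨hT.le, le_rfl⟩
    rwa [hr2, hr1] at this
  · have e1 : (fun r => u r x) =ᶠ[nhdsWithin r₂ (Iic r₂)] fun r => u (r₁ + r₂ - r) x := by
      filter_upwards [Icc_mem_nhdsLE (show r_m < r₂ by linarith)] with r hr
      have := hrefl x (r - r_m) ⟨by linarith [hr.1], by linarith [hr.2]⟩
      rw [show r_m + (r - r_m) = r by ring] at this
      rw [this]
      congr 1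
      rw [hm]; ring
    rw [e1.derivWithin_eq (e1.self_of_nhdsWithin (by simp)),
      derivWithin_comp_const_sub (fun r => u r x)]
    rw [aux_vadd, add_sub_cancel_right]

end
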